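/- arXiv:1702.03642 — 9 statements merged into one kernel-verified Lean document; each statement's English description precedes it below -/
import Mathlib

section
/- Fix real parameters A, B and consider the open set Ω of points (u,v) ∈ ℝ² with u² ≠ 1, v ≠ 0. Define H(u,v) = (v² + A² + 2uAB + B²)/(1 − u²) + u, F(u,v) = −2u + H(u,v) + ((3u² − 2H(u,v)u − 1 − 2AB)/(2v))², and G(u,v) = −v − (F(u,v) − u)(3u² − 2H(u,v)u − 1 − 2AB)/(2v). Then at every point of Ω one has (∂F/∂u · ∂G/∂v − ∂F/∂v · ∂G/∂u)·(u² − 1) = 2·(F(u,v)² − 1). In other words, since the Poisson bracket of u = cos θ and v = sin θ·p_θ equals {u,v} = u² − 1, the doubling map (u,v) ↦ (F,G) is a canonical transformation of valence 2 for the Lagrange top. -/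
/-- The divisor-doubling map `(u,v) ↦ (F,G)` for the Lagrange top is a
canonical transformation of valence 2: its Jacobian determinant `J`
satisfies `J·(u² − 1) = 2·(F² − 1)` at every point of the open set
`Ω = {(u,v) : u² ≠ 1, v ≠ 0}`.  Here `{u,v} = u² − 1` is the Poisson
bracket of `u = cos θ` and `v = sin θ·p_θ`. -/
theorem lagrange_doubling_is_canonical_valence_two
    (A B : ℝ)
    (H F G : ℝ → ℝ → ℝ)
    (hH : ∀ u v, H u v = (v ^ 2 + A ^ 2 + 2 * u * A * B + B ^ 2) / (1 - u ^ 2) + u)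
    (hF : ∀ u v, F u v = -2 * u + H u v +
      ((3 * u ^ 2 - 2 * H u v * u - 1 - 2 * A * B) / (2 * v)) ^ 2)
    (hG : ∀ u v, G u v = -v -
      (F u v - u) * (3 * u ^ 2 - 2 * H u v * u - 1 - 2 * A * B) / (2 * v)) :
    ∀ u v : ℝ, u ^ 2 ≠ 1 → v ≠ 0 →
      (deriv (fun s => F s v) u * deriv (fun s => G u s) v -
       deriv (fun s => F u s) v * deriv (fun s => G s v) u) * (u ^ 2 - 1) =
      2 * ((F u v) ^ 2 - 1) := by
  intro u v hu hv
  have hd : 1 - u ^ 2 ≠ 0 := sub_ne_zero.mpr hu.symm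
  set h := H u v with hh
  set m := (3 * u ^ 2 - 2 * h * u - 1 - 2 * A * B) / (2 * v) with hm
  have hHu : HasDerivAt (fun s => H s v) (-2 * v * m / (1 - u ^ 2)) u := by
    simp only [hH]
    have hnum : HasDerivAt (fun s : ℝ => v ^ 2 + A ^ 2 + 2 * s * A * B + B ^ 2)
        (2 * 1 * A * B) u :=
      (((((hasDerivAt_id u).const_mul 2).mul_const A).mul_const B).const_add _).add_const _
    have hden : HasDerivAt (fun s : ℝ => 1 - s ^ 2) (-(2 * u)) u := by
      simpa using (hasDerivAt_pow 2 u).const_sub 1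
    refine ((hnum.div hden hd).add (hasDerivAt_id u)).congr_deriv ?_
    rw [hm, hh, hH]
    field_simp
    ring
  have hHv : HasDerivAt (fun s => H u s) (2 * v / (1 - u ^ 2)) v := by
    simp only [hH]
    have hsq : HasDerivAt (fun s : ℝ => s ^ 2) (2 * v) v := by
      simpa using hasDerivAt_pow 2 v
    exact ((((hsq.add_const _).add_const _).add_const _).div_const _).add_const _
  have key : ∀ (x y : ℝ → ℝ) (x' y' h' t : ℝ), HasDerivAt x x' t → HasDerivAt y y' t →
      HasDerivAt (fun s => H (x s) (y s)) h' t → x t = u → y t = v →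
      HasDerivAt (fun s => F (x s) (y s)) (-2 * x' + h' + 2 * m *
        ((3 * u * x' - h' * u - h * x' - m * y') / v)) t ∧
      HasDerivAt (fun s => G (x s) (y s)) (-y' - ((-2 * x' + h' + 2 * m *
        ((3 * u * x' - h' * u - h * x' - m * y') / v)) - x') * m
        - (F u v - u) * ((3 * u * x' - h' * u - h * x' - m * y') / v)) t := by
    intro x y x' y' h' t hx hy hxy hxt hyt
    have hslope : HasDerivAt
        (fun s => (3 * x s ^ 2 - 2 * H (x s) (y s) * x s - 1 - 2 * A * B) / (2 * y s))
        ((3 * u * x' - h' * u - h * x' - m * y') / v) t := by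
      refine ((((((hx.pow 2).const_mul 3).sub ((hxy.const_mul 2).mul hx)).sub_const 1).sub_const
        (2 * A * B)).div (hy.const_mul 2) (by simpa [hyt] using hv)).congr_deriv ?_
      simp only [hxt, hyt, ← hh, hm, Pi.sub_apply, Pi.mul_apply, Pi.pow_apply]
      field_simp
      ring
    have hFt : HasDerivAt (fun s => F (x s) (y s)) (-2 * x' + h' + 2 * m *
        ((3 * u * x' - h' * u - h * x' - m * y') / v)) t := by
      simp only [hF]
      refine (((hx.const_mul (-2)).add hxy).add (hslope.pow 2)).congr_deriv ?_
      simp only [hxt, hyt, ← hh, ← hm]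
      ring
    refine ⟨hFt, ?_⟩
    simp only [hG, mul_div_assoc]
    refine (hy.neg.sub ((hFt.sub hx).mul hslope)).congr_deriv ?_
    simp only [hxt, hyt, ← hh, ← hm, Pi.sub_apply]
    ring
  obtain ⟨hFu, hGu⟩ := key (fun s => s) (fun _ => v) 1 0 _ u (hasDerivAt_id u)
    (hasDerivAt_const u v) hHu rfl rfl
  obtain ⟨hFv, hGv⟩ := key (fun _ => u) (fun s => s) 0 1 _ v (hasDerivAt_const v u)
    (hasDerivAt_id v) hHv rfl rfl
  rw [hFu.deriv, hGu.deriv, hFv.deriv, hGv.deriv, hF u v, ← hh, ← hm]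
  clear_value m h
  field_simp
  ring
end

section
/- Let E, A, B, u, v be real numbers with v² = g(u) and v ≠ 0, where g(x) = (E − x)(1 − x²) − A² − 2ABx − B². Define the real polynomial P(z) = v − (z − u)(2AB + E(z + u) − 3zu + 1)/(2v) − (z − u)²(2AB + 2Eu − 3u² + 1)²/(8v³). Then (z − u)³ divides P(z)² − g(z) in ℝ[z]; i.e. the curve y = P(z) meets the Lagrange elliptic curve y² = g(z) with multiplicity three at the point (u, v), which underlies the tripling (valence three) Bäcklund transformation of the Lagrange top. -/
open Polynomial

/-- The parabola `y = P(z)` of the tripling construction meets the Lagrange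
elliptic curve `y² = g(z)`, `g(x) = (E − x)(1 − x²) − A² − 2ABx − B²`, with
multiplicity three at the point `(u,v)`: `(z − u)³` divides `P(z)² − g(z)`. -/
theorem lagrange_tripling_third_order_contact
    (E A B u v : ℝ) (hv0 : v ≠ 0)
    (hcurve : v ^ 2 = (E - u) * (1 - u ^ 2) - A ^ 2 - 2 * A * B * u - B ^ 2)
    (P g : Polynomial ℝ)
    (hP : P = C v
      - C (1 / (2 * v)) * (X - C u) *
        (C (2 * A * B + 1) + C E * (X + C u) - C (3 * u) * X)
      - C ((2 * A * B + 2 * E * u - 3 * u ^ 2 + 1) ^ 2 / (8 * v ^ 3)) *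
        (X - C u) ^ 2)
    (hg : g = (C E - X) * (1 - X ^ 2) - C (A ^ 2) - C (2 * A * B) * X - C (B ^ 2)) :
    (X - C u) ^ 3 ∣ P ^ 2 - g := by
  set D : ℝ := 2 * A * B + 2 * E * u - 3 * u ^ 2 + 1 with hD
  obtain ⟨a, ha⟩ : ∃ a : ℝ, a = -D / (2 * v) := ⟨_, rfl⟩
  obtain ⟨b, hb⟩ : ∃ b : ℝ, b = -(E - 3 * u) / (2 * v) - D ^ 2 / (8 * v ^ 3) := ⟨_, rfl⟩
  have hlin : 2 * v * a = -D := by rw [ha]; field_simp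
  have hquad : a ^ 2 + 2 * v * b = -(E - 3 * u) := by rw [ha, hb]; field_simp; ring
  have hP' : P = C v + C a * (X - C u) + C b * (X - C u) ^ 2 := by
    rw [hP]
    refine Polynomial.funext fun z => ?_
    simp only [eval_add, eval_sub, eval_mul, eval_pow, eval_C, eval_X]
    rw [ha, hb, hD]
    field_simp
    ring
  refine ⟨C (2 * a * b - 1) + C (b ^ 2) * (X - C u), ?_⟩
  rw [hP', hg]
  refine Polynomial.funext fun z => ?_
  simp only [eval_add, eval_sub, eval_mul, eval_pow, eval_C, eval_X, eval_one]
  linear_combination hcurve + (z - u) * hlin + (z - u) ^ 2 * hquad - (z - u) * hD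
end

section
/- Let a₃, a₂, a₁, a₀ be real numbers, set f(x) = a₃x³ + a₂x² + a₁x + a₀, and let (x, y) satisfy y² = f(x) with y ≠ 0. Define the polynomial P(z) = y + (z − x)(3a₃xz + a₂(z + x) + a₁)/(2y) − (z − x)²(3a₃x² + 2a₂x + a₁)²/(8y³). Then (z − x)³ divides P(z)² − f(z) in ℝ[z]; i.e. the parabola y = P(z) meets the curve y² = f(z) with multiplicity three at (x, y), which realizes tripling [3]P of the point P = (x,y). -/
open Polynomial

/-- The parabola `y = P(z)` of the tripling construction meets the elliptic
curve `y² = f(z)`, `f(z) = a₃z³ + a₂z² + a₁z + a₀`, with multiplicity three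
at the point `(x,y)`: `(z − x)³` divides `P(z)² − f(z)`. -/
theorem elliptic_tripling_third_order_contact
    (a₃ a₂ a₁ a₀ x y : ℝ) (hy0 : y ≠ 0)
    (hcurve : y ^ 2 = a₃ * x ^ 3 + a₂ * x ^ 2 + a₁ * x + a₀)
    (P f : Polynomial ℝ)
    (hP : P = C y
      + C (1 / (2 * y)) * (X - C x) *
        (C (3 * a₃ * x) * X + C a₂ * (X + C x) + C a₁)
      - C ((3 * a₃ * x ^ 2 + 2 * a₂ * x + a₁) ^ 2 / (8 * y ^ 3)) * (X - C x) ^ 2)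
    (hf : f = C a₃ * X ^ 3 + C a₂ * X ^ 2 + C a₁ * X + C a₀) :
    (X - C x) ^ 3 ∣ P ^ 2 - f := by
  have hinv : (2 : ℝ[X]) * C y * C (1 / (2 * y)) = 1 := by
    rw [← C_ofNat, ← C_mul, ← C_mul, ← C_1]
    congr 1
    field_simp
  have hcurveC : C y ^ 2 = C a₃ * C x ^ 3 + C a₂ * C x ^ 2 + C a₁ * C x + C a₀ := by
    simp only [← C_mul, ← C_pow, ← C_add, hcurve]
  have hsecond : (3 * a₃ * x ^ 2 + 2 * a₂ * x + a₁) ^ 2 / (8 * y ^ 3)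
      = (3 * a₃ * x ^ 2 + 2 * a₂ * x + a₁) ^ 2 * (1 / (2 * y)) ^ 3 := by
    ring
  rw [hP, hf, hsecond]
  simp only [C_mul, C_pow, C_add, C_ofNat]
  generalize C (1 / (2 * y)) = i at *
  -- `D` and `2 * E` are the first and second derivatives of `f` at `x`.
  let D : ℝ[X] := 3 * C a₃ * C x ^ 2 + 2 * C a₂ * C x + C a₁
  let E : ℝ[X] := 3 * C a₃ * C x + C a₂
  let q : ℝ[X] := E * i - D ^ 2 * i ^ 3
  refine ⟨2 * (D * i) * q - C a₃ + q ^ 2 * (X - C x), ?_⟩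
  linear_combination hcurveC +
    (D * (X - C x) + (E - D ^ 2 * i ^ 2) * (X - C x) ^ 2) * hinv
end

section
/- Let f ∈ ℝ[X] be a polynomial, let x₁ ≠ x₂ be real numbers and y₁, y₂ nonzero real numbers with y₁² = f(x₁) and y₂² = f(x₂). Let P ∈ ℝ[X] be any polynomial satisfying P(x₁) = y₁, P(x₂) = y₂, P'(x₁) = f'(x₁)/(2y₁) and P'(x₂) = f'(x₂)/(2y₂), where P' and f' denote formal derivatives. Then (X − x₁)²·(X − x₂)² divides P(X)² − f(X) in ℝ[X]; i.e. the Abel polynomial ψ = P² − f has double roots at x₁ and x₂, which is the geometric mechanism behind doubling of the divisor P₁ + P₂ on the hyperelliptic curve y² = f(x). -/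
open Polynomial

theorem X_sub_C_sq_dvd_of_isRoot_of_isRoot_derivative {R : Type*} [CommRing R]
    {p : R[X]} {a : R} (h : p.IsRoot a) (h' : p.derivative.IsRoot a) :
    (X - C a) ^ 2 ∣ p := by
  obtain ⟨q, rfl⟩ := dvd_iff_isRoot.mpr h
  have hq : q.IsRoot a := by simpa [IsRoot, derivative_mul] using h'
  rw [sq]
  exact mul_dvd_mul_left _ (dvd_iff_isRoot.mpr hq)

theorem X_sub_C_sq_dvd_sq_sub_of_tangent {K : Type*} [Field K] [NeZero (2 : K)]
    {f P : K[X]} {x y : K} (hy : y ≠ 0) (hf : y ^ 2 = f.eval x) (hP : P.eval x = y)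
    (hP' : P.derivative.eval x = f.derivative.eval x / (2 * y)) :
    (X - C x) ^ 2 ∣ P ^ 2 - f := by
  apply X_sub_C_sq_dvd_of_isRoot_of_isRoot_derivative
  · simp [IsRoot, hP, hf]
  · rw [eq_div_iff (mul_ne_zero two_ne_zero hy)] at hP'
    simp only [IsRoot, derivative_sub, derivative_sq, eval_sub, eval_mul, eval_C, hP]
    linear_combination hP'

/-- Divisor doubling on the hyperelliptic curve `y² = f(x)`: if the plane
curve `y = P(x)` passes through the two points `(x₁,y₁)`, `(x₂,y₂)` of the
curve and is tangent to it there (`P'(xᵢ) = f'(xᵢ)/(2yᵢ)`), then the Abel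
polynomial `ψ = P² − f` has double roots at `x₁` and `x₂`. -/
theorem abel_polynomial_double_roots
    (f P : Polynomial ℝ) (x₁ x₂ y₁ y₂ : ℝ)
    (hx : x₁ ≠ x₂) (hy₁ : y₁ ≠ 0) (hy₂ : y₂ ≠ 0)
    (hf₁ : y₁ ^ 2 = f.eval x₁) (hf₂ : y₂ ^ 2 = f.eval x₂)
    (hP₁ : P.eval x₁ = y₁) (hP₂ : P.eval x₂ = y₂)
    (hP₁' : P.derivative.eval x₁ = f.derivative.eval x₁ / (2 * y₁))
    (hP₂' : P.derivative.eval x₂ = f.derivative.eval x₂ / (2 * y₂)) :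
    (X - C x₁) ^ 2 * (X - C x₂) ^ 2 ∣ P ^ 2 - f := by
  exact (isCoprime_X_sub_C_of_isUnit_sub (sub_ne_zero.mpr hx).isUnit).pow.mul_dvd
    (X_sub_C_sq_dvd_sq_sub_of_tangent hy₁ hf₁ hP₁ hP₁')
    (X_sub_C_sq_dvd_sq_sub_of_tangent hy₂ hf₂ hP₂ hP₂')
end

section
/- Let a be a real parameter and define on ℝ⁴ (coordinates q₁, q₂, p₁, p₂) the Hénon–Heiles Hamiltonians H₁ = (p₁² + p₂²)/4 − 4a·q₂(q₁² + 2q₂²) and H₂ = p₁(q₁p₂ − q₂p₁)/2 − a·q₁²(q₁² + 4q₂²). Then the canonical Poisson bracket vanishes identically: {H₁, H₂} = Σᵢ₌₁² (∂H₁/∂qᵢ · ∂H₂/∂pᵢ − ∂H₁/∂pᵢ · ∂H₂/∂qᵢ) = 0 at every point of ℝ⁴; i.e. H₁ and H₂ are in involution and define an integrable system. -/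
/-- The canonical Poisson bracket on `ℝ⁴` with coordinates `(q₁,q₂,p₁,p₂)`:
`{F,G} = Σᵢ (∂F/∂qᵢ·∂G/∂pᵢ − ∂F/∂pᵢ·∂G/∂qᵢ)`, with partial derivatives
expressed through `deriv` of the coordinate sections. -/
noncomputable def poissonBracket (F G : ℝ → ℝ → ℝ → ℝ → ℝ)
    (q₁ q₂ p₁ p₂ : ℝ) : ℝ :=
  deriv (fun s => F s q₂ p₁ p₂) q₁ * deriv (fun s => G q₁ q₂ s p₂) p₁
  - deriv (fun s => F q₁ q₂ s p₂) p₁ * deriv (fun s => G s q₂ p₁ p₂) q₁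
  + deriv (fun s => F q₁ s p₁ p₂) q₂ * deriv (fun s => G q₁ q₂ p₁ s) p₂
  - deriv (fun s => F q₁ q₂ p₁ s) p₂ * deriv (fun s => G q₁ s p₁ p₂) q₂

/-- The derivative of a real quartic polynomial in terms of its coefficients. -/
theorem deriv_quartic (c₀ c₁ c₂ c₃ c₄ x : ℝ) :
    deriv (fun s : ℝ => c₀ + c₁ * s + c₂ * s ^ 2 + c₃ * s ^ 3 + c₄ * s ^ 4) x =
      c₁ + 2 * c₂ * x + 3 * c₃ * x ^ 2 + 4 * c₄ * x ^ 3 := by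
  have h := (((((hasDerivAt_id x).const_mul c₁).const_add c₀).add
    ((hasDerivAt_pow 2 x).const_mul c₂)).add ((hasDerivAt_pow 3 x).const_mul c₃)).add
    ((hasDerivAt_pow 4 x).const_mul c₄)
  refine HasDerivAt.deriv (h.congr_deriv ?_)
  norm_num
  ring

/-- The derivative of a function given by a real quartic polynomial. -/
theorem deriv_eq_of_eq_quartic {f : ℝ → ℝ} (c₀ c₁ c₂ c₃ c₄ x : ℝ)
    (hf : ∀ s, f s = c₀ + c₁ * s + c₂ * s ^ 2 + c₃ * s ^ 3 + c₄ * s ^ 4) :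
    deriv f x = c₁ + 2 * c₂ * x + 3 * c₃ * x ^ 2 + 4 * c₄ * x ^ 3 := by
  rw [funext hf, deriv_quartic]

/-- The Hénon–Heiles Hamiltonians `H₁ = (p₁² + p₂²)/4 − 4a·q₂(q₁² + 2q₂²)`
and `H₂ = p₁(q₁p₂ − q₂p₁)/2 − a·q₁²(q₁² + 4q₂²)` are in involution with
respect to the canonical Poisson bracket on `ℝ⁴`. -/
theorem henon_heiles_involution
    (a : ℝ) (H₁ H₂ : ℝ → ℝ → ℝ → ℝ → ℝ)
    (hH₁ : ∀ q₁ q₂ p₁ p₂, H₁ q₁ q₂ p₁ p₂ =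
      (p₁ ^ 2 + p₂ ^ 2) / 4 - 4 * a * q₂ * (q₁ ^ 2 + 2 * q₂ ^ 2))
    (hH₂ : ∀ q₁ q₂ p₁ p₂, H₂ q₁ q₂ p₁ p₂ =
      p₁ * (q₁ * p₂ - q₂ * p₁) / 2 - a * q₁ ^ 2 * (q₁ ^ 2 + 4 * q₂ ^ 2)) :
    ∀ q₁ q₂ p₁ p₂ : ℝ, poissonBracket H₁ H₂ q₁ q₂ p₁ p₂ = 0 := by
  intro q₁ q₂ p₁ p₂
  rw [poissonBracket,
    deriv_eq_of_eq_quartic ((p₁ ^ 2 + p₂ ^ 2) / 4 - 8 * a * q₂ ^ 3) 0 (-4 * a * q₂) 0 0 q₁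
      fun s => by rw [hH₁]; ring,
    deriv_eq_of_eq_quartic (-a * q₁ ^ 2 * (q₁ ^ 2 + 4 * q₂ ^ 2)) (q₁ * p₂ / 2) (-q₂ / 2) 0 0 p₁
      fun s => by rw [hH₂]; ring,
    deriv_eq_of_eq_quartic (p₂ ^ 2 / 4 - 4 * a * q₂ * (q₁ ^ 2 + 2 * q₂ ^ 2)) 0 (1 / 4) 0 0 p₁
      fun s => by rw [hH₁]; ring,
    deriv_eq_of_eq_quartic (-q₂ * p₁ ^ 2 / 2) (p₁ * p₂ / 2) (-4 * a * q₂ ^ 2) 0 (-a) q₁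
      fun s => by rw [hH₂]; ring,
    deriv_eq_of_eq_quartic ((p₁ ^ 2 + p₂ ^ 2) / 4) (-4 * a * q₁ ^ 2) 0 (-8 * a) 0 q₂
      fun s => by rw [hH₁]; ring,
    deriv_eq_of_eq_quartic (-q₂ * p₁ ^ 2 / 2 - a * q₁ ^ 2 * (q₁ ^ 2 + 4 * q₂ ^ 2))
      (p₁ * q₁ / 2) 0 0 0 p₂ fun s => by rw [hH₂]; ring,
    deriv_eq_of_eq_quartic (p₁ ^ 2 / 4 - 4 * a * q₂ * (q₁ ^ 2 + 2 * q₂ ^ 2)) 0 (1 / 4) 0 0 p₂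
      fun s => by rw [hH₁]; ring,
    deriv_eq_of_eq_quartic (p₁ * q₁ * p₂ / 2 - a * q₁ ^ 4) (-p₁ ^ 2 / 2) (-4 * a * q₁ ^ 2) 0 0 q₂
      fun s => by rw [hH₂]; ring]
  ring
end

section
/- Let a, q₁, q₂, p₁, p₂, r be real numbers with q₁ ≠ 0, r ≠ 0 and r² = q₁² + q₂². Set u₁ = q₂ − r, u₂ = q₂ + r, p_{u₁} = p₂/2 − p₁(q₂ + r)/(2q₁), p_{u₂} = p₂/2 − p₁(q₂ − r)/(2q₁). Then u₁u₂·(p_{u₁}² − p_{u₂}²)/(u₂ − u₁) + a·u₁u₂(u₁² + u₁u₂ + u₂²) = p₁(q₁p₂ − q₂p₁)/2 − a·q₁²(q₁² + 4q₂²); i.e. the second Hénon–Heiles Hamiltonian H₂ takes the stated separable form in parabolic coordinates. -/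
/-- The second Hénon–Heiles Hamiltonian
`H₂ = p₁(q₁p₂ − q₂p₁)/2 − a·q₁²(q₁² + 4q₂²)` takes the separable form
`u₁u₂(p_{u₁}² − p_{u₂}²)/(u₂ − u₁) + a·u₁u₂(u₁² + u₁u₂ + u₂²)`
in parabolic coordinates. -/
theorem henon_heiles_H2_parabolic_form
    (a q₁ q₂ p₁ p₂ r : ℝ)
    (hq₁ : q₁ ≠ 0) (hr0 : r ≠ 0) (hr : r ^ 2 = q₁ ^ 2 + q₂ ^ 2)
    (u₁ u₂ pu₁ pu₂ : ℝ)
    (hu₁ : u₁ = q₂ - r) (hu₂ : u₂ = q₂ + r)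
    (hpu₁ : pu₁ = p₂ / 2 - p₁ * (q₂ + r) / (2 * q₁))
    (hpu₂ : pu₂ = p₂ / 2 - p₁ * (q₂ - r) / (2 * q₁)) :
    u₁ * u₂ * (pu₁ ^ 2 - pu₂ ^ 2) / (u₂ - u₁)
      + a * u₁ * u₂ * (u₁ ^ 2 + u₁ * u₂ + u₂ ^ 2) =
    p₁ * (q₁ * p₂ - q₂ * p₁) / 2 - a * q₁ ^ 2 * (q₁ ^ 2 + 4 * q₂ ^ 2) := by
  have hprod : u₁ * u₂ = -q₁ ^ 2 := by
    rw [hu₁, hu₂]; linear_combination -hr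
  have hsum : u₁ ^ 2 + u₁ * u₂ + u₂ ^ 2 = q₁ ^ 2 + 4 * q₂ ^ 2 := by
    rw [hu₁, hu₂]; linear_combination hr
  have hdiff : u₂ - u₁ = 2 * r := by
    rw [hu₁, hu₂]; ring
  have hkin : -q₁ ^ 2 * (pu₁ ^ 2 - pu₂ ^ 2) / (2 * r) = p₁ * (q₁ * p₂ - q₂ * p₁) / 2 := by
    rw [hpu₁, hpu₂]
    field_simp
    ring
  rw [mul_assoc a, hsum, hprod, hdiff, hkin]
  ring
end

section
/- On the open subset of ℝ⁴ where q₁ ≠ 0, let H₁ = (p₁² + p₂²)/4 − 4a·q₂(q₁² + 2q₂²), r = √(q₁² + q₂²), u₁ = q₂ − r, u₂ = q₂ + r, p_{u₁} = p₂/2 − p₁(q₂ + r)/(2q₁), p_{u₂} = p₂/2 − p₁(q₂ − r)/(2q₁), all functions of (q₁, q₂, p₁, p₂). Then the canonical Poisson brackets satisfy {u₁, H₁} = 2p_{u₁}·u₁/(u₁ − u₂) and {u₂, H₁} = 2p_{u₂}·u₂/(u₂ − u₁) at every such point; i.e. the parabolic coordinates obey the stated Hamilton equations with respect to H₁. -/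
/-- The bracket of `q₂ + ε r`, with `r = √(q₁² + q₂²)`, and a Hamiltonian with kinetic energy
`(p₁² + p₂²) / 4` and any potential depending on the positions only. -/
theorem poissonBracket_add_mul_sqrt (ε : ℝ) (V : ℝ → ℝ → ℝ) {q₁ q₂ : ℝ} (p₁ p₂ : ℝ)
    (hq : q₁ ^ 2 + q₂ ^ 2 ≠ 0) :
    poissonBracket (fun x y _ _ => y + ε * √(x ^ 2 + y ^ 2))
        (fun x y s t => (s ^ 2 + t ^ 2) / 4 - V x y) q₁ q₂ p₁ p₂ =
      ε * (q₁ / √(q₁ ^ 2 + q₂ ^ 2)) * (p₁ / 2)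
        + (1 + ε * (q₂ / √(q₁ ^ 2 + q₂ ^ 2))) * (p₂ / 2) := by
  have hF₁ : HasDerivAt (fun s => q₂ + ε * √(s ^ 2 + q₂ ^ 2))
      (ε * (q₁ / √(q₁ ^ 2 + q₂ ^ 2))) q₁ := by
    refine (((((hasDerivAt_pow 2 q₁).add_const (q₂ ^ 2)).sqrt hq).const_mul ε).const_add
      q₂).congr_deriv ?_
    simp [mul_div_mul_left]
  have hF₂ : HasDerivAt (fun s => s + ε * √(q₁ ^ 2 + s ^ 2))
      (1 + ε * (q₂ / √(q₁ ^ 2 + q₂ ^ 2))) q₂ := by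
    refine ((hasDerivAt_id q₂).add
      ((((hasDerivAt_pow 2 q₂).const_add (q₁ ^ 2)).sqrt hq).const_mul ε)).congr_deriv ?_
    simp [mul_div_mul_left]
  have hG₁ : HasDerivAt (fun s => (s ^ 2 + p₂ ^ 2) / 4 - V q₁ q₂) (p₁ / 2) p₁ := by
    refine ((((hasDerivAt_pow 2 p₁).add_const (p₂ ^ 2)).div_const 4).sub_const
      (V q₁ q₂)).congr_deriv ?_
    norm_num
    ring
  have hG₂ : HasDerivAt (fun s => (p₁ ^ 2 + s ^ 2) / 4 - V q₁ q₂) (p₂ / 2) p₂ := by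
    refine ((((hasDerivAt_pow 2 p₂).const_add (p₁ ^ 2)).div_const 4).sub_const
      (V q₁ q₂)).congr_deriv ?_
    norm_num
    ring
  simp only [poissonBracket, hF₁.deriv, hF₂.deriv, hG₁.deriv, hG₂.deriv, deriv_const, zero_mul,
    sub_zero]

/-- Hamilton equations for the parabolic coordinates with respect to the
first Hénon–Heiles Hamiltonian `H₁`: on the open set `q₁ ≠ 0` one has
`{u₁, H₁} = 2p_{u₁}u₁/(u₁ − u₂)` and `{u₂, H₁} = 2p_{u₂}u₂/(u₂ − u₁)`. -/
theorem henon_heiles_hamilton_equations_H1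
    (a : ℝ) (H₁ u₁ u₂ pu₁ pu₂ : ℝ → ℝ → ℝ → ℝ → ℝ)
    (hH₁ : ∀ q₁ q₂ p₁ p₂, H₁ q₁ q₂ p₁ p₂ =
      (p₁ ^ 2 + p₂ ^ 2) / 4 - 4 * a * q₂ * (q₁ ^ 2 + 2 * q₂ ^ 2))
    (hu₁ : ∀ q₁ q₂ p₁ p₂, u₁ q₁ q₂ p₁ p₂ = q₂ - Real.sqrt (q₁ ^ 2 + q₂ ^ 2))
    (hu₂ : ∀ q₁ q₂ p₁ p₂, u₂ q₁ q₂ p₁ p₂ = q₂ + Real.sqrt (q₁ ^ 2 + q₂ ^ 2))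
    (hpu₁ : ∀ q₁ q₂ p₁ p₂, pu₁ q₁ q₂ p₁ p₂ =
      p₂ / 2 - p₁ * (q₂ + Real.sqrt (q₁ ^ 2 + q₂ ^ 2)) / (2 * q₁))
    (hpu₂ : ∀ q₁ q₂ p₁ p₂, pu₂ q₁ q₂ p₁ p₂ =
      p₂ / 2 - p₁ * (q₂ - Real.sqrt (q₁ ^ 2 + q₂ ^ 2)) / (2 * q₁)) :
    ∀ q₁ q₂ p₁ p₂ : ℝ, q₁ ≠ 0 →
      poissonBracket u₁ H₁ q₁ q₂ p₁ p₂ =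
        2 * pu₁ q₁ q₂ p₁ p₂ * u₁ q₁ q₂ p₁ p₂ /
          (u₁ q₁ q₂ p₁ p₂ - u₂ q₁ q₂ p₁ p₂) ∧
      poissonBracket u₂ H₁ q₁ q₂ p₁ p₂ =
        2 * pu₂ q₁ q₂ p₁ p₂ * u₂ q₁ q₂ p₁ p₂ /
          (u₂ q₁ q₂ p₁ p₂ - u₁ q₁ q₂ p₁ p₂) := by
  intro q₁ q₂ p₁ p₂ hq₁
  have hq : 0 < q₁ ^ 2 + q₂ ^ 2 := by positivity
  have hH : H₁ = fun x y s t => (s ^ 2 + t ^ 2) / 4 - 4 * a * y * (x ^ 2 + 2 * y ^ 2) := by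
    funext x y s t
    exact hH₁ x y s t
  have hU₁ : u₁ = fun x y _ _ => y + (-1) * √(x ^ 2 + y ^ 2) := by
    funext x y s t
    rw [hu₁]
    ring
  have hU₂ : u₂ = fun x y _ _ => y + 1 * √(x ^ 2 + y ^ 2) := by
    funext x y s t
    rw [hu₂]
    ring
  have hB (ε : ℝ) := poissonBracket_add_mul_sqrt ε
    (fun x y => 4 * a * y * (x ^ 2 + 2 * y ^ 2)) p₁ p₂ hq.ne'
  have hr : √(q₁ ^ 2 + q₂ ^ 2) ≠ 0 := (Real.sqrt_pos.2 hq).ne'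
  have hr2 : √(q₁ ^ 2 + q₂ ^ 2) ^ 2 = q₁ ^ 2 + q₂ ^ 2 := Real.sq_sqrt hq.le
  rw [hpu₁, hpu₂, hH, hU₁, hU₂, hB, hB]
  beta_reduce
  generalize √(q₁ ^ 2 + q₂ ^ 2) = r at hr hr2 ⊢
  have h₁ : q₂ + -1 * r - (q₂ + 1 * r) = -(2 * r) := by ring
  have h₂ : q₂ + 1 * r - (q₂ + -1 * r) = 2 * r := by ring
  rw [h₁, h₂]
  constructor
  · field_simp
    linear_combination p₁ * hr2
  · field_simp
    linear_combination -p₁ * hr2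
end

section
/- Let a ∈ ℂ, a ≠ 0, and let q₁, q₂, p₁, p₂ ∈ ℂ be such that B := 4q₁(p₁²q₁ + 2p₁p₂q₂ − p₂²q₁) ≠ 0 and N := 8a·q₁(p₁q₁² + 6p₁q₂² − 2p₂q₁q₂) − p₂p₁² ≠ 0. Define b₀ = (−8a·q₁⁴(2p₁q₁q₂ − p₂q₁² − 2p₂q₂²) + q₁²p₁(p₁²q₁ + 2p₁p₂q₂ − 2p₂²q₁))/B, b₁ = (−8a·q₁²(p₁q₁³ + 10p₁q₁q₂² − 4p₂q₁²q₂ − 4p₂q₂³) − 2p₁³q₁q₂ + 3p₁²p₂q₁² − 4p₁²p₂q₂² + 4p₁p₂²q₁q₂ − 2p₂³q₁²)/B, b₂ = (−8a·q₁(12p₁q₂³ + p₂q₁³ − 2p₂q₁q₂²) + p₁²(p₁q₁ + 4p₂q₂))/B, b₃ = N/B. Define q̃₂ = −2q₂ + (64q₁²(12p₁q₂³ + p₂q₁³ − 2p₂q₁q₂²)(p₁q₁² + 6p₁q₂² − 2p₂q₁q₂)a² + p₁⁴p₂(p₁q₁ + 4p₂q₂) − 8a·q₁(6p₁⁴q₁q₂²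 − 2p₁³p₂q₁²q₂ + 36p₁³p₂q₂³ + 3p₁²p₂²q₁³ − 14p₁²p₂²q₁q₂² + 4p₁p₂³q₁²q₂ − p₂⁴q₁³))/N², Q = −((8a·q₁²(2p₁q₁q₂ − p₂q₁² − 2p₂q₂²) − p₁(p₁²q₁ + 2p₁p₂q₂ − 2p₂²q₁))/N)² (so Q = q̃₁²; assume Q ≠ 0), P = −2b₀ − 2Q(b₂ + 2q̃₂b₃) (so P = q̃₁p̃₁), and p̃₂ = −2(Q + 4q̃₂²)b₃ − 4q̃₂b₂ − 2b₁. Then (P²/Q + p̃₂²)/4 − 4a·q̃₂(Q + 2q̃₂²) = (p₁² + p₂²)/4 − 4a·q₂(q₁² + 2q₂²); i.e. the divisor-doubling transformation preserves the form of the first Hénon–Heiles Hamiltonian H₁. -/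
/-- If `b(x)² - (a x⁵ + h x² + g x)` is divisible by `x² - 2 t x - Q`, with quotient
`b₃² (x² - 2 q₂ x - q₁²)²` (all coefficients except the linear one are compared), then the value
`h` is recovered from the remainder of `b` modulo `x² - 2 t x - Q`. -/
theorem henonHeiles_eq_of_coeff_eq {F : Type*} [Field F] [CharZero F]
    {a h q₁ q₂ b₀ b₁ b₂ b₃ t Q : F} (hQ : Q ≠ 0)
    (c₅ : a = 2 * b₃ * b₂ + b₃ ^ 2 * (2 * t + 4 * q₂))
    (c₄ : b₂ ^ 2 + 2 * b₃ * b₁ = b₃ ^ 2 * (-Q + 8 * q₂ * t + (4 * q₂ ^ 2 - 2 * q₁ ^ 2)))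
    (c₃ : 2 * b₃ * b₀ + 2 * b₂ * b₁ =
      b₃ ^ 2 * (4 * q₂ * Q - 2 * t * (4 * q₂ ^ 2 - 2 * q₁ ^ 2) + 4 * q₁ ^ 2 * q₂))
    (c₂ : b₁ ^ 2 + 2 * b₂ * b₀ =
      h + b₃ ^ 2 * (-(4 * q₂ ^ 2 - 2 * q₁ ^ 2) * Q - 8 * t * q₁ ^ 2 * q₂ + q₁ ^ 4))
    (c₀ : b₀ ^ 2 = -(b₃ ^ 2 * q₁ ^ 4 * Q)) :
    ((-2 * b₀ - 2 * Q * (b₂ + 2 * t * b₃)) ^ 2 / Q +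
        (-2 * (Q + 4 * t ^ 2) * b₃ - 4 * t * b₂ - 2 * b₁) ^ 2) / 4 -
      4 * a * t * (Q + 2 * t ^ 2) = h := by
  field_simp
  linear_combination 4 * (c₀ + Q * c₂ + 2 * t * Q * c₃ + Q * (4 * t ^ 2 + Q) * c₄
    - Q * (8 * t ^ 3 + 4 * t * Q) * c₅)

/-- The divisor-doubling auto-Bäcklund transformation of the Hénon–Heiles
system preserves the form of the first Hamiltonian
`H₁ = (p₁² + p₂²)/4 − 4a·q₂(q₁² + 2q₂²)`.  Here `Q = q̃₁²`, `P = q̃₁p̃₁`, so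
that `H₁` evaluated on the image equals `(P²/Q + p̃₂²)/4 − 4a·q̃₂(Q + 2q̃₂²)`. -/
theorem henon_heiles_doubling_preserves_H1
    (a q₁ q₂ p₁ p₂ : ℂ) (ha : a ≠ 0)
    (B N b₀ b₁ b₂ b₃ q₂t Q P p₂t : ℂ)
    (hB : B = 4 * q₁ * (p₁ ^ 2 * q₁ + 2 * p₁ * p₂ * q₂ - p₂ ^ 2 * q₁))
    (hB0 : B ≠ 0)
    (hN : N = 8 * a * q₁ * (p₁ * q₁ ^ 2 + 6 * p₁ * q₂ ^ 2 - 2 * p₂ * q₁ * q₂)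
      - p₂ * p₁ ^ 2)
    (hN0 : N ≠ 0)
    (hb₀ : b₀ = (-8 * a * q₁ ^ 4 * (2 * p₁ * q₁ * q₂ - p₂ * q₁ ^ 2 - 2 * p₂ * q₂ ^ 2)
      + q₁ ^ 2 * p₁ * (p₁ ^ 2 * q₁ + 2 * p₁ * p₂ * q₂ - 2 * p₂ ^ 2 * q₁)) / B)
    (hb₁ : b₁ = (-8 * a * q₁ ^ 2 * (p₁ * q₁ ^ 3 + 10 * p₁ * q₁ * q₂ ^ 2
        - 4 * p₂ * q₁ ^ 2 * q₂ - 4 * p₂ * q₂ ^ 3)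
      - 2 * p₁ ^ 3 * q₁ * q₂ + 3 * p₁ ^ 2 * p₂ * q₁ ^ 2 - 4 * p₁ ^ 2 * p₂ * q₂ ^ 2
      + 4 * p₁ * p₂ ^ 2 * q₁ * q₂ - 2 * p₂ ^ 3 * q₁ ^ 2) / B)
    (hb₂ : b₂ = (-8 * a * q₁ * (12 * p₁ * q₂ ^ 3 + p₂ * q₁ ^ 3 - 2 * p₂ * q₁ * q₂ ^ 2)
      + p₁ ^ 2 * (p₁ * q₁ + 4 * p₂ * q₂)) / B)
    (hb₃ : b₃ = N / B)
    (hq₂t : q₂t = -2 * q₂ +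
      (64 * q₁ ^ 2 * (12 * p₁ * q₂ ^ 3 + p₂ * q₁ ^ 3 - 2 * p₂ * q₁ * q₂ ^ 2)
          * (p₁ * q₁ ^ 2 + 6 * p₁ * q₂ ^ 2 - 2 * p₂ * q₁ * q₂) * a ^ 2
        + p₁ ^ 4 * p₂ * (p₁ * q₁ + 4 * p₂ * q₂)
        - 8 * a * q₁ * (6 * p₁ ^ 4 * q₁ * q₂ ^ 2 - 2 * p₁ ^ 3 * p₂ * q₁ ^ 2 * q₂
          + 36 * p₁ ^ 3 * p₂ * q₂ ^ 3 + 3 * p₁ ^ 2 * p₂ ^ 2 * q₁ ^ 3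
          - 14 * p₁ ^ 2 * p₂ ^ 2 * q₁ * q₂ ^ 2 + 4 * p₁ * p₂ ^ 3 * q₁ ^ 2 * q₂
          - p₂ ^ 4 * q₁ ^ 3)) / N ^ 2)
    (hQ : Q = -(((8 * a * q₁ ^ 2 * (2 * p₁ * q₁ * q₂ - p₂ * q₁ ^ 2 - 2 * p₂ * q₂ ^ 2)
      - p₁ * (p₁ ^ 2 * q₁ + 2 * p₁ * p₂ * q₂ - 2 * p₂ ^ 2 * q₁)) / N) ^ 2))
    (hQ0 : Q ≠ 0)
    (hP : P = -2 * b₀ - 2 * Q * (b₂ + 2 * q₂t * b₃))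
    (hp₂t : p₂t = -2 * (Q + 4 * q₂t ^ 2) * b₃ - 4 * q₂t * b₂ - 2 * b₁) :
    (P ^ 2 / Q + p₂t ^ 2) / 4 - 4 * a * q₂t * (Q + 2 * q₂t ^ 2) =
      (p₁ ^ 2 + p₂ ^ 2) / 4 - 4 * a * q₂ * (q₁ ^ 2 + 2 * q₂ ^ 2) := by
  have hN2 : N ^ 2 ≠ 0 := pow_ne_zero 2 hN0
  have hB2 : B ^ 2 ≠ 0 := pow_ne_zero 2 hB0
  have hn₀ := (eq_div_iff hB0).1 hb₀
  have hn₁ := (eq_div_iff hB0).1 hb₁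
  have hn₂ := (eq_div_iff hB0).1 hb₂
  have hn₃ := (eq_div_iff hB0).1 hb₃
  have hT := eq_div_iff hN2 |>.1 (eq_sub_of_add_eq' hq₂t.symm).symm
  have hK := eq_div_iff hN2 |>.1 ((neg_eq_iff_eq_neg.2 hQ).trans (div_pow _ _ 2))
  have hT' : B ^ 2 * (b₃ ^ 2 * q₂t) = (q₂t - -2 * q₂) * N ^ 2 - 2 * q₂ * N ^ 2 := by
    rw [← hn₃]; ring
  have hK' : B ^ 2 * (b₃ ^ 2 * Q) = -(-Q * N ^ 2) := by
    rw [← hn₃]; ring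
  rw [hT] at hT'
  rw [hK] at hK'
  rw [hP, hp₂t]
  apply henonHeiles_eq_of_coeff_eq (q₁ := q₁) (q₂ := q₂) hQ0
  · apply mul_left_cancel₀ hB2
    trans a * B ^ 2
    · ring
    trans 2 * (b₃ * B) * (b₂ * B) + 2 * (B ^ 2 * (b₃ ^ 2 * q₂t)) +
        4 * q₂ * (b₃ * B) ^ 2
    · rw [hT', hn₂, hn₃, hB, hN]
      ring
    · ring
  · apply mul_left_cancel₀ hB2
    trans (b₂ * B) ^ 2 + 2 * (b₃ * B) * (b₁ * B)
    · ring
    trans -(B ^ 2 * (b₃ ^ 2 * Q)) + 8 * q₂ * (B ^ 2 * (b₃ ^ 2 * q₂t)) +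
        (4 * q₂ ^ 2 - 2 * q₁ ^ 2) * (b₃ * B) ^ 2
    · rw [hT', hK', hn₁, hn₂, hn₃, hN]
      ring
    · ring
  · apply mul_left_cancel₀ hB2
    trans 2 * (b₃ * B) * (b₀ * B) + 2 * (b₂ * B) * (b₁ * B)
    · ring
    trans 4 * q₂ * (B ^ 2 * (b₃ ^ 2 * Q)) -
        2 * (4 * q₂ ^ 2 - 2 * q₁ ^ 2) * (B ^ 2 * (b₃ ^ 2 * q₂t)) +
        4 * q₁ ^ 2 * q₂ * (b₃ * B) ^ 2
    · rw [hT', hK', hn₀, hn₁, hn₂, hn₃, hN]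
      ring
    · ring
  · apply mul_left_cancel₀ hB2
    trans (b₁ * B) ^ 2 + 2 * (b₂ * B) * (b₀ * B)
    · ring
    trans ((p₁ ^ 2 + p₂ ^ 2) / 4 - 4 * a * q₂ * (q₁ ^ 2 + 2 * q₂ ^ 2)) * B ^ 2 -
        (4 * q₂ ^ 2 - 2 * q₁ ^ 2) * (B ^ 2 * (b₃ ^ 2 * Q)) -
        8 * q₁ ^ 2 * q₂ * (B ^ 2 * (b₃ ^ 2 * q₂t)) + q₁ ^ 4 * (b₃ * B) ^ 2
    · rw [hT', hK', hn₀, hn₁, hn₂, hn₃, hB, hN]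
      ring
    · ring
  · apply mul_left_cancel₀ hB2
    trans (b₀ * B) ^ 2
    · ring
    trans -(q₁ ^ 4 * (B ^ 2 * (b₃ ^ 2 * Q)))
    · rw [hK', hn₀]
      ring
    · ring
end

section
/- Let a ∈ ℂ, a ≠ 0, and let q₁, q₂, p₁, p₂ ∈ ℂ be such that B := 4q₁(p₁²q₁ + 2p₁p₂q₂ − p₂²q₁) ≠ 0 and N := 8a·q₁(p₁q₁² + 6p₁q₂² − 2p₂q₁q₂) − p₂p₁² ≠ 0. Define b₀ = (−8a·q₁⁴(2p₁q₁q₂ − p₂q₁² − 2p₂q₂²) + q₁²p₁(p₁²q₁ + 2p₁p₂q₂ − 2p₂²q₁))/B, b₁ = (−8a·q₁²(p₁q₁³ + 10p₁q₁q₂² − 4p₂q₁²q₂ − 4p₂q₂³) − 2p₁³q₁q₂ + 3p₁²p₂q₁² − 4p₁²p₂q₂² + 4p₁p₂²q₁q₂ − 2p₂³q₁²)/B, b₂ = (−8a·q₁(12p₁q₂³ + p₂q₁³ − 2p₂q₁q₂²) + p₁²(p₁q₁ + 4p₂q₂))/B, b₃ = N/B. Define q̃₂ = −2q₂ + (64q₁²(12p₁q₂³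 + p₂q₁³ − 2p₂q₁q₂²)(p₁q₁² + 6p₁q₂² − 2p₂q₁q₂)a² + p₁⁴p₂(p₁q₁ + 4p₂q₂) − 8a·q₁(6p₁⁴q₁q₂² − 2p₁³p₂q₁²q₂ + 36p₁³p₂q₂³ + 3p₁²p₂²q₁³ − 14p₁²p₂²q₁q₂² + 4p₁p₂³q₁²q₂ − p₂⁴q₁³))/N², Q = −((8a·q₁²(2p₁q₁q₂ − p₂q₁² − 2p₂q₂²) − p₁(p₁²q₁ + 2p₁p₂q₂ − 2p₂²q₁))/N)² (so Q = q̃₁²; assume Q ≠ 0), P = −2b₀ − 2Q(b₂ + 2q̃₂b₃) (so P = q̃₁p̃₁), and p̃₂ = −2(Q + 4q̃₂²)b₃ − 4q̃₂b₂ − 2b₁. Then P·p̃₂/2 − q̃₂·P²/(2Q) − a·Q(Q + 4q̃₂²) = p₁(q₁p₂ − q₂p₁)/2 − a·q₁²(q₁² + 4q₂²); i.e. the divisor-doubling transformation preserves the form of the second Hénon–Heiles Hamiltonian H₂. -/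
/-- Let `V = b₃x³ + b₂x² + b₁x + b₀`, `U = x² - 2ux - w` and `Ũ = x² - 2tx - Q`.  If the
coefficients of `V² - (ax⁵ + hx² + kx)` and of `b₃²U²Ũ` agree in degrees `0, 1, 3, 4, 5`, then
reducing `V` modulo `Ũ` recovers `k` as the second Hénon–Heiles Hamiltonian of `Ũ`. -/
theorem henon_heiles_H2_eq_of_sq_sub_eq {K : Type*} [Field K] [NeZero (2 : K)]
    {a k u w b₀ b₁ b₂ b₃ t Q P s : K} (hQ0 : Q ≠ 0)
    (hP : P = -2 * b₀ - 2 * Q * (b₂ + 2 * t * b₃))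
    (hs : s = -2 * (Q + 4 * t ^ 2) * b₃ - 4 * t * b₂ - 2 * b₁)
    (h₀ : b₀ ^ 2 = b₃ ^ 2 * (-Q * w ^ 2))
    (h₁ : 2 * b₀ * b₁ - k = b₃ ^ 2 * (-4 * Q * u * w - 2 * t * w ^ 2))
    (h₃ : 2 * b₀ * b₃ + 2 * b₁ * b₂ =
      b₃ ^ 2 * (4 * Q * u - 2 * t * (4 * u ^ 2 - 2 * w) + 4 * u * w))
    (h₄ : b₂ ^ 2 + 2 * b₁ * b₃ = b₃ ^ 2 * (-Q + 8 * t * u + 4 * u ^ 2 - 2 * w))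
    (h₅ : 2 * b₂ * b₃ - a = b₃ ^ 2 * (-2 * t - 4 * u)) :
    P * s / 2 - t * P ^ 2 / (2 * Q) - a * Q * (Q + 4 * t ^ 2) = k := by
  have h2 : (2 : K) ≠ 0 := NeZero.ne 2
  obtain ⟨p, rfl⟩ : ∃ p, P = 2 * p := ⟨-b₀ - Q * (b₂ + 2 * t * b₃), by rw [hP]; ring⟩
  obtain ⟨r, rfl⟩ : ∃ r, s = 2 * r :=
    ⟨-(Q + 4 * t ^ 2) * b₃ - 2 * t * b₂ - b₁, by rw [hs]; ring⟩
  have hp : p = -b₀ - Q * (b₂ + 2 * t * b₃) := mul_left_cancel₀ h2 (by rw [hP]; ring)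
  have hr : r = -(Q + 4 * t ^ 2) * b₃ - 2 * t * b₂ - b₁ :=
    mul_left_cancel₀ h2 (by rw [hs]; ring)
  -- `w₀, …, w₃` are the coefficients of the quotient of `(rx + p)² - (ax⁵ + hx² + kx)` by `Ũ`.
  obtain ⟨w₀, hw₀⟩ : ∃ z, z = b₃ ^ 2 * w ^ 2 - (b₂ + 2 * t * b₃) * (b₀ - p) := ⟨_, rfl⟩
  obtain ⟨w₁, hw₁⟩ : ∃ z, z = 4 * b₃ ^ 2 * u * w - b₃ * (b₀ - p)
      - (b₂ + 2 * t * b₃) * (b₁ - r) := ⟨_, rfl⟩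
  obtain ⟨w₂, hw₂⟩ : ∃ z, z = b₃ ^ 2 * (4 * u ^ 2 - 2 * w) - b₃ * (b₁ - r)
      - (b₂ + 2 * t * b₃) * b₂ := ⟨_, rfl⟩
  obtain ⟨w₃, hw₃⟩ : ∃ z, z = -4 * b₃ ^ 2 * u - b₃ * b₂ - (b₂ + 2 * t * b₃) * b₃ := ⟨_, rfl⟩
  have e₀ : p ^ 2 = -Q * w₀ := by
    rw [hw₀, hp]; linear_combination h₀
  have e₁ : 2 * r * p - k = -2 * t * w₀ - Q * w₁ := by
    rw [hw₀, hw₁, hp, hr]; linear_combination h₁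
  have e₃ : w₁ = 2 * t * w₂ + Q * w₃ := by
    rw [hw₁, hw₂, hw₃, hp, hr]; linear_combination -h₃
  have e₄ : w₂ = 2 * t * w₃ := by
    rw [hw₂, hw₃, hr]; linear_combination -h₄
  have e₅ : w₃ = -a := by
    rw [hw₃]; linear_combination -h₅
  have e : t * (2 * p) ^ 2 / (2 * Q) = -2 * t * w₀ := by
    rw [div_eq_iff (mul_ne_zero h2 hQ0)]; linear_combination 4 * t * e₀
  rw [e, mul_div_assoc, mul_div_cancel_left₀ _ h2]
  linear_combination e₁ - Q * e₃ - 2 * t * Q * e₄ - (4 * t ^ 2 * Q + Q ^ 2) * e₅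

/-- The divisor-doubling auto-Bäcklund transformation of the Hénon–Heiles
system preserves the form of the second Hamiltonian
`H₂ = p₁(q₁p₂ − q₂p₁)/2 − a·q₁²(q₁² + 4q₂²)`.  Here `Q = q̃₁²`, `P = q̃₁p̃₁`, so
that `H₂` evaluated on the image equals `P·p̃₂/2 − q̃₂·P²/(2Q) − a·Q(Q + 4q̃₂²)`. -/
theorem henon_heiles_doubling_preserves_H2
    (a q₁ q₂ p₁ p₂ : ℂ) (ha : a ≠ 0)
    (B N b₀ b₁ b₂ b₃ q₂t Q P p₂t : ℂ)
    (hB : B = 4 * q₁ * (p₁ ^ 2 * q₁ + 2 * p₁ * p₂ * q₂ - p₂ ^ 2 * q₁))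
    (hB0 : B ≠ 0)
    (hN : N = 8 * a * q₁ * (p₁ * q₁ ^ 2 + 6 * p₁ * q₂ ^ 2 - 2 * p₂ * q₁ * q₂)
      - p₂ * p₁ ^ 2)
    (hN0 : N ≠ 0)
    (hb₀ : b₀ = (-8 * a * q₁ ^ 4 * (2 * p₁ * q₁ * q₂ - p₂ * q₁ ^ 2 - 2 * p₂ * q₂ ^ 2)
      + q₁ ^ 2 * p₁ * (p₁ ^ 2 * q₁ + 2 * p₁ * p₂ * q₂ - 2 * p₂ ^ 2 * q₁)) / B)
    (hb₁ : b₁ = (-8 * a * q₁ ^ 2 * (p₁ * q₁ ^ 3 + 10 * p₁ * q₁ * q₂ ^ 2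
        - 4 * p₂ * q₁ ^ 2 * q₂ - 4 * p₂ * q₂ ^ 3)
      - 2 * p₁ ^ 3 * q₁ * q₂ + 3 * p₁ ^ 2 * p₂ * q₁ ^ 2 - 4 * p₁ ^ 2 * p₂ * q₂ ^ 2
      + 4 * p₁ * p₂ ^ 2 * q₁ * q₂ - 2 * p₂ ^ 3 * q₁ ^ 2) / B)
    (hb₂ : b₂ = (-8 * a * q₁ * (12 * p₁ * q₂ ^ 3 + p₂ * q₁ ^ 3 - 2 * p₂ * q₁ * q₂ ^ 2)
      + p₁ ^ 2 * (p₁ * q₁ + 4 * p₂ * q₂)) / B)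
    (hb₃ : b₃ = N / B)
    (hq₂t : q₂t = -2 * q₂ +
      (64 * q₁ ^ 2 * (12 * p₁ * q₂ ^ 3 + p₂ * q₁ ^ 3 - 2 * p₂ * q₁ * q₂ ^ 2)
          * (p₁ * q₁ ^ 2 + 6 * p₁ * q₂ ^ 2 - 2 * p₂ * q₁ * q₂) * a ^ 2
        + p₁ ^ 4 * p₂ * (p₁ * q₁ + 4 * p₂ * q₂)
        - 8 * a * q₁ * (6 * p₁ ^ 4 * q₁ * q₂ ^ 2 - 2 * p₁ ^ 3 * p₂ * q₁ ^ 2 * q₂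
          + 36 * p₁ ^ 3 * p₂ * q₂ ^ 3 + 3 * p₁ ^ 2 * p₂ ^ 2 * q₁ ^ 3
          - 14 * p₁ ^ 2 * p₂ ^ 2 * q₁ * q₂ ^ 2 + 4 * p₁ * p₂ ^ 3 * q₁ ^ 2 * q₂
          - p₂ ^ 4 * q₁ ^ 3)) / N ^ 2)
    (hQ : Q = -(((8 * a * q₁ ^ 2 * (2 * p₁ * q₁ * q₂ - p₂ * q₁ ^ 2 - 2 * p₂ * q₂ ^ 2)
      - p₁ * (p₁ ^ 2 * q₁ + 2 * p₁ * p₂ * q₂ - 2 * p₂ ^ 2 * q₁)) / N) ^ 2))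
    (hQ0 : Q ≠ 0)
    (hP : P = -2 * b₀ - 2 * Q * (b₂ + 2 * q₂t * b₃))
    (hp₂t : p₂t = -2 * (Q + 4 * q₂t ^ 2) * b₃ - 4 * q₂t * b₂ - 2 * b₁) :
    P * p₂t / 2 - q₂t * P ^ 2 / (2 * Q) - a * Q * (Q + 4 * q₂t ^ 2) =
      p₁ * (q₁ * p₂ - q₂ * p₁) / 2 - a * q₁ ^ 2 * (q₁ ^ 2 + 4 * q₂ ^ 2) := by
  have hNt := hq₂t
  have hNQ := hQ
  rw [← sub_eq_iff_eq_add', eq_div_iff (pow_ne_zero 2 hN0)] at hNt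
  rw [div_pow, ← neg_div, eq_div_iff (pow_ne_zero 2 hN0)] at hNQ
  refine henon_heiles_H2_eq_of_sq_sub_eq (u := q₂) (w := q₁ ^ 2) hQ0 hP hp₂t ?_ ?_ ?_ ?_ ?_
    <;> clear hq₂t hQ hP hp₂t hQ0 <;> simp only [hb₀, hb₁, hb₂, hb₃] <;> field_simp
  · linear_combination (norm := (simp only [hN]; ring)) q₁ ^ 4 * hNQ
  · linear_combination (norm := (simp only [hB, hN]; ring))
      8 * q₂ * q₁ ^ 2 * hNQ + 4 * q₁ ^ 4 * hNt
  · linear_combination (norm := (simp only [hN]; ring))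
      -4 * q₂ * hNQ + 2 * (4 * q₂ ^ 2 - 2 * q₁ ^ 2) * hNt
  · linear_combination (norm := (simp only [hN]; ring)) hNQ - 8 * q₂ * hNt
  · linear_combination (norm := (simp only [hB, hN]; ring)) 2 * hNt
end
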